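/- Let H and V be real Hilbert spaces, ι : V → H an injective compact bounded linear operator with dense range, and I ⊆ ℝ an open interval. Let s ↦ D(s) be a map from I to the bounded symmetric self-adjoint operators V → H that is continuous in the operator norm and weakly differentiable, i.e. for every x ∈ H and ξ ∈ V the function s ↦ ⟨x, D(s) ξ⟩_H is differentiable. Let s₀ ∈ I be a regular crossing: the bilinear form Γ on ker D(s₀) defined by Γ(ξ, η) := (d/ds)|_{s = s₀} ⟨ι ξ, D(s) η⟩_H is nondegenerate, i.e. if ξ ∈ ker D(s₀) satisfies Γ(ξ, η) = 0 for all η ∈ ker D(s₀) then ξ = 0. Then there exists δ > 0 such that D(s) : V → H is bijective for every s ∈ I with 0 < |s − s₀| < δ. -/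

import Mathlib

open scoped RealInnerProductSpace

/-- `D : V → H` is symmetric with respect to the inclusion `ι : V → H`. -/
def IsSymmetricOp {H V : Type*} [NormedAddCommGroup H] [InnerProductSpace ℝ H]
    [NormedAddCommGroup V] [InnerProductSpace ℝ V]
    (ι : V →L[ℝ] H) (D : V →L[ℝ] H) : Prop :=
  ∀ x ξ : V, ⟪D x, ι ξ⟫ = ⟪ι x, D ξ⟫

/-- `D : V → H` is self-adjoint: it is symmetric, and an element `x ∈ H` lies in `ι(V)`
if and only if the supremum of `|⟨x, D ξ⟩| / ‖ι ξ‖` over `0 ≠ ξ ∈ V` is finite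
(equivalently, `|⟨x, D ξ⟩| ≤ C ‖ι ξ‖` for some constant `C`). -/
def IsSelfAdjointOp {H V : Type*} [NormedAddCommGroup H] [InnerProductSpace ℝ H]
    [NormedAddCommGroup V] [InnerProductSpace ℝ V]
    (ι : V →L[ℝ] H) (D : V →L[ℝ] H) : Prop :=
  IsSymmetricOp ι D ∧
    ∀ x : H, (x ∈ Set.range ι ↔ ∃ C : ℝ, ∀ ξ : V, |⟪x, D ξ⟫| ≤ C * ‖ι ξ‖)

section

open Filter Topology

variable {H V : Type*} [NormedAddCommGroup H] [InnerProductSpace ℝ H]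
  [NormedAddCommGroup V] [InnerProductSpace ℝ V] {ι D : V →L[ℝ] H}

/-- The graph `{(D ξ, ι ξ)}` of a self-adjoint operator is closed. -/
theorem IsSelfAdjointOp.isClosed_range_prod (hD : IsSelfAdjointOp ι D) (hι : DenseRange ι) :
    IsClosed (Set.range (D.prod ι)) := by
  refine IsSeqClosed.isClosed fun u p hu hup => ?_
  choose ξ hξ using hu
  obtain ⟨y, x⟩ := p
  obtain rfl : (fun n => (D (ξ n), ι (ξ n))) = u := funext hξ
  rw [Prod.tendsto_iff] at hup
  obtain ⟨hy, hx⟩ := hup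
  have hxy (η : V) : ⟪y, ι η⟫ = ⟪x, D η⟫ :=
    tendsto_nhds_unique (hy.inner tendsto_const_nhds)
      ((hx.inner tendsto_const_nhds).congr fun n => (hD.1 (ξ n) η).symm)
  obtain ⟨ζ, rfl⟩ := (hD.2 x).2 ⟨‖y‖, fun η => hxy η ▸ abs_real_inner_le_norm y (ι η)⟩
  refine ⟨ζ, Prod.ext (hι.eq_of_inner_left (𝕜 := ℝ) fun η => ?_) rfl⟩
  exact (hD.1 ζ η).trans (hxy η).symm

/-- If `ι` is compact and `D` is self-adjoint, a sequence of unit vectors `x n` with `D (x n) → 0`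
subconverges to a unit vector in the kernel of `D`. -/
theorem IsSelfAdjointOp.exists_tendsto_subseq [CompleteSpace H] [CompleteSpace V]
    (hD : IsSelfAdjointOp ι D) (hι_inj : Function.Injective ι) (hι_cpt : IsCompactOperator ι)
    (hι_dense : DenseRange ι) {x : ℕ → V} (hx : ∀ n, ‖x n‖ = 1)
    (hDx : Tendsto (fun n => D (x n)) atTop (𝓝 0)) :
    ∃ ξ : V, ∃ φ : ℕ → ℕ, StrictMono φ ∧ Tendsto (x ∘ φ) atTop (𝓝 ξ) ∧ D ξ = 0 ∧ ‖ξ‖ = 1 := by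
  have hclosed := hD.isClosed_range_prod hι_dense
  have hinj : Function.Injective (D.prod ι) := fun a b hab => hι_inj (congrArg Prod.snd hab)
  obtain ⟨K, hK⟩ := (D.prod ι).antilipschitz_of_injective_of_isClosed_range hinj hclosed
  obtain ⟨S, hS, hιS⟩ := hι_cpt.image_closedBall_subset_compact (𝕜₁ := ℝ) (f := ι.toLinearMap) 1
  obtain ⟨z, -, φ, hφ, hz⟩ := hS.tendsto_subseq (x := fun n => ι (x n))
    fun n => hιS ⟨x n, by simp [hx n], rfl⟩
  have hlim : Tendsto (fun n => D.prod ι (x (φ n))) atTop (𝓝 (0, z)) :=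
    (hDx.comp hφ.tendsto_atTop).prodMk_nhds hz
  obtain ⟨ξ, hξ⟩ := hclosed.mem_of_tendsto hlim (.of_forall fun n => ⟨_, rfl⟩)
  have hemb := hK.isClosedEmbedding (D.prod ι).uniformContinuous
  have hxξ : Tendsto (x ∘ φ) atTop (𝓝 ξ) :=
    hemb.isInducing.tendsto_nhds_iff.2 (hξ ▸ hlim)
  refine ⟨ξ, φ, hφ, hxξ, congrArg Prod.fst hξ, ?_⟩
  exact tendsto_nhds_unique hxξ.norm (tendsto_const_nhds.congr fun n => (hx (φ n)).symm)

/-- If `ι` is compact, an injective self-adjoint operator has closed range. -/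
theorem IsSelfAdjointOp.isClosed_range [CompleteSpace H] [CompleteSpace V]
    (hD : IsSelfAdjointOp ι D) (hι_inj : Function.Injective ι) (hι_cpt : IsCompactOperator ι)
    (hι_dense : DenseRange ι) (hD_inj : ∀ ξ, D ξ = 0 → ξ = 0) : IsClosed (Set.range D) := by
  rw [D.isClosed_range_iff_antilipschitz_of_injective ((injective_iff_map_eq_zero D).2 hD_inj),
    antilipschitzWith_iff_exists_mul_le_norm]
  by_contra! h
  choose x hx using fun n : ℕ => h (1 / ((n : ℝ) + 1)) Nat.one_div_pos_of_nat
  have hx0 (n : ℕ) : 0 < ‖x n‖ := by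
    refine norm_pos_iff.2 fun h0 => ?_
    simpa [h0] using hx n
  obtain ⟨ξ, -, -, -, hξ, hξ1⟩ := hD.exists_tendsto_subseq hι_inj hι_cpt hι_dense
    (x := fun n => ‖x n‖⁻¹ • x n)
    (fun n => by rw [norm_smul, norm_inv, norm_norm, inv_mul_cancel₀ (hx0 n).ne'])
    (squeeze_zero_norm (fun n => by
      rw [map_smul, norm_smul, norm_inv, norm_norm, inv_mul_le_iff₀ (hx0 n), mul_comm]
      exact (hx n).le) tendsto_one_div_add_atTop_nhds_zero_nat)
  simp [hD_inj ξ hξ] at hξ1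

/-- If `ι` is compact, an injective self-adjoint operator is bijective. -/
theorem IsSelfAdjointOp.bijective [CompleteSpace H] [CompleteSpace V]
    (hD : IsSelfAdjointOp ι D) (hι_inj : Function.Injective ι) (hι_cpt : IsCompactOperator ι)
    (hι_dense : DenseRange ι) (hD_inj : ∀ ξ, D ξ = 0 → ξ = 0) : Function.Bijective D := by
  refine ⟨(injective_iff_map_eq_zero D).2 hD_inj, ?_⟩
  have hclosed : IsClosed (D.range : Set H) :=
    hD.isClosed_range hι_inj hι_cpt hι_dense hD_inj
  have : CompleteSpace D.range := hclosed.completeSpace_coe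
  refine LinearMap.range_eq_top.1 ((Submodule.orthogonal_eq_bot_iff (K := D.range)).1 ?_)
  refine (Submodule.eq_bot_iff _).2 fun x hx => ?_
  have hx' (ξ : V) : ⟪x, D ξ⟫ = 0 :=
    (Submodule.mem_orthogonal' _ _).1 hx _ (LinearMap.mem_range_self _ ξ)
  obtain ⟨ζ, rfl⟩ := (hD.2 x).2 ⟨0, fun ξ => by simp [hx' ξ]⟩
  have hζ : D ζ = 0 := hι_dense.eq_of_inner_left (𝕜 := ℝ) fun η => by
    rw [hD.1 ζ η, hx' η, inner_zero_left]
  rw [hD_inj ζ hζ, map_zero]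

/-- A strongly convergent sequence may be paired with a weakly convergent one. -/
theorem tendsto_inner_of_tendsto_of_forall_tendsto_inner [CompleteSpace H] {u v : ℕ → H} {a : H}
    {f : H → ℝ} (hu : Tendsto u atTop (𝓝 a))
    (hv : ∀ y, Tendsto (fun n => ⟪y, v n⟫) atTop (𝓝 (f y))) :
    Tendsto (fun n => ⟪u n, v n⟫) atTop (𝓝 (f a)) := by
  obtain ⟨C, hC⟩ : ∃ C, ∀ n, ‖innerSL ℝ (v n)‖ ≤ C := banach_steinhaus fun y => by
    obtain ⟨C, hC⟩ := (hv y).norm.bddAbove_range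
    exact ⟨C, fun n => by simpa [real_inner_comm] using hC ⟨n, rfl⟩⟩
  have h0 : Tendsto (fun n => ⟪u n - a, v n⟫) atTop (𝓝 0) := by
    refine squeeze_zero_norm (a := fun n => ‖u n - a‖ * C) (fun n => ?_) ?_
    · refine (norm_inner_le_norm _ _).trans ?_
      gcongr
      simpa using hC n
    · simpa using (tendsto_iff_norm_sub_tendsto_zero.1 hu).mul_const C
  simpa [inner_sub_left] using h0.add (hv a)

/-- Let `D t` be symmetric for `t` in `I` and let `ξ` be the limit of vectors in the kernels of
`D (s n)`, where `s n → s₀`. Then the crossing form of `D` at `s₀` vanishes on `(ξ, η)` for every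
`η` in the kernel of `D s₀`. -/
theorem deriv_inner_eq_zero_of_tendsto [CompleteSpace H] {D : ℝ → (V →L[ℝ] H)} {s₀ : ℝ}
    {s : ℕ → ℝ} (hs : Tendsto s atTop (𝓝[≠] s₀)) (hsymm : ∀ n, IsSymmetricOp ι (D (s n)))
    {x : ℕ → V} (hx : ∀ n, D (s n) (x n) = 0) {ξ η : V} (hxξ : Tendsto x atTop (𝓝 ξ))
    (hη : D s₀ η = 0)
    (hdiff : ∀ y : H, DifferentiableAt ℝ (fun t => ⟪y, D t η⟫) s₀) :
    deriv (fun t => ⟪ι ξ, D t η⟫) s₀ = 0 := by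
  have hv (y : H) : Tendsto (fun n => ⟪y, (s n - s₀)⁻¹ • D (s n) η⟫) atTop
      (𝓝 (deriv (fun t => ⟪y, D t η⟫) s₀)) :=
    ((hdiff y).hasDerivAt.tendsto_slope.comp hs).congr fun n => by
      simp [slope_def_module, hη, inner_smul_right]
  have hlim := tendsto_inner_of_tendsto_of_forall_tendsto_inner
    ((ι.continuous.tendsto ξ).comp hxξ) hv
  refine tendsto_nhds_unique hlim (tendsto_const_nhds.congr fun n => ?_)
  rw [Function.comp_apply, inner_smul_right, ← hsymm n (x n) η, hx n, inner_zero_left, mul_zero]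

end

/-- At a regular crossing `s₀` of a weakly differentiable path of self-adjoint operators,
the operators `D(s)` are bijective for all `s ≠ s₀` close to `s₀`. -/
theorem bijective_near_regular_crossing
    {H V : Type*} [NormedAddCommGroup H] [InnerProductSpace ℝ H] [CompleteSpace H]
    [NormedAddCommGroup V] [InnerProductSpace ℝ V] [CompleteSpace V]
    (ι : V →L[ℝ] H) (hι_inj : Function.Injective ι)
    (hι_cpt : IsCompactOperator ι) (hι_dense : DenseRange ι)
    (I : Set ℝ) (hIopen : IsOpen I) (hIconn : I.OrdConnected)
    (D : ℝ → (V →L[ℝ] H))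
    (hsa : ∀ s ∈ I, IsSelfAdjointOp ι (D s))
    (hcont : ContinuousOn D I)
    (hdiff : ∀ (x : H) (ξ : V), ∀ s ∈ I,
      DifferentiableAt ℝ (fun t => ⟪x, D t ξ⟫) s)
    (s₀ : ℝ) (hs₀ : s₀ ∈ I)
    (hreg : ∀ ξ : V, D s₀ ξ = 0 →
      (∀ η : V, D s₀ η = 0 → deriv (fun s => ⟪ι ξ, D s η⟫) s₀ = 0) → ξ = 0) :
    ∃ δ : ℝ, 0 < δ ∧ ∀ s ∈ I, s ≠ s₀ → |s - s₀| < δ → Function.Bijective (D s) := by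
  by_contra! h
  choose s hsI hne hlt hbij using fun n : ℕ =>
    h (1 / ((n : ℝ) + 1)) Nat.one_div_pos_of_nat
  have hker (n : ℕ) : ∃ x, D (s n) x = 0 ∧ ‖x‖ = 1 := by
    by_contra! hn
    refine hbij n ((hsa _ (hsI n)).bijective hι_inj hι_cpt hι_dense fun ξ hξ => ?_)
    by_contra hξ0
    refine hn (‖ξ‖⁻¹ • ξ) (by rw [map_smul, hξ, smul_zero]) ?_
    rw [norm_smul, norm_inv, norm_norm, inv_mul_cancel₀ (norm_ne_zero_iff.2 hξ0)]
  choose x hx hx1 using hker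
  have hs : Filter.Tendsto s Filter.atTop (nhds s₀) :=
    tendsto_iff_norm_sub_tendsto_zero.2 <| squeeze_zero (fun _ => norm_nonneg _)
      (fun n => (hlt n).le) tendsto_one_div_add_atTop_nhds_zero_nat
  have hDs : Filter.Tendsto (fun n => ‖D (s n) - D s₀‖) Filter.atTop (nhds 0) :=
    tendsto_iff_norm_sub_tendsto_zero.1
      ((hcont.continuousAt (hIopen.mem_nhds hs₀)).tendsto.comp hs)
  have hDx : Filter.Tendsto (fun n => D s₀ (x n)) Filter.atTop (nhds 0) :=
    squeeze_zero_norm (fun n => by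
      simpa [hx n, hx1 n] using (D (s n) - D s₀).le_opNorm (x n)) hDs
  obtain ⟨ξ, φ, hφ, hxξ, hξ, hξ1⟩ :=
    (hsa s₀ hs₀).exists_tendsto_subseq hι_inj hι_cpt hι_dense hx1 hDx
  have hs' : Filter.Tendsto (s ∘ φ) Filter.atTop (nhdsWithin s₀ {s₀}ᶜ) :=
    tendsto_nhdsWithin_iff.2 ⟨hs.comp hφ.tendsto_atTop, .of_forall fun n => hne (φ n)⟩
  have hξ0 : ξ = 0 := hreg ξ hξ fun η hη =>
    deriv_inner_eq_zero_of_tendsto hs' (fun n => (hsa _ (hsI (φ n))).1) (fun n => hx (φ n)) hxξ hη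
      fun y => hdiff y η s₀ hs₀
  simp [hξ0] at hξ1
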